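/- Let (R,m) be a noetherian local ring, I a proper ideal of R, n ≥ 1, and f_1, …, f_n ∈ I. Assume H^l_I(R) = 0 for all l ≠ n. Then √I = √((f_1,…,f_n)R) if and only if f_1, …, f_n is a regular sequence on the Matlis dual D(H^n_I(R)). -/

import Mathlib

open IsLocalRing

/-- The underlying `R`-module of the `i`-th local cohomology of the `R`-module `M`
with support in the ideal `I`. -/
noncomputable abbrev LocalCohomologyModule {R : Type} [CommRing R] (I : Ideal R) (i : ℕ)
    (M : Type) [AddCommGroup M] [Module R M] : ModuleCat R :=
  (localCohomology I i).obj (ModuleCat.of R M)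

/-- `E` is an injective hull of the residue field of the local ring `R`. -/
def IsInjectiveHullOfResidueField (R : Type) [CommRing R] [IsLocalRing R]
    (E : Type) [AddCommGroup E] [Module R E] : Prop :=
  Module.Injective R E ∧
    ∃ f : ResidueField R →ₗ[R] E, Function.Injective f ∧
      ∀ N : Submodule R E, N ≠ ⊥ → N ⊓ LinearMap.range f ≠ ⊥

section

open CategoryTheory Abelian

universe u

namespace ExtColimit

variable {R : Type u} [CommRing R] (I : Ideal R)

/-- The projection `R ⧸ I ^ t → R ⧸ I ^ s` for `s ≤ t`. -/
def proj {s t : ℕ} (h : s ≤ t) :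
    ModuleCat.of R (R ⧸ I ^ t) ⟶ ModuleCat.of R (R ⧸ I ^ s) :=
  ModuleCat.ofHom (Submodule.mapQ _ _ LinearMap.id (Ideal.pow_le_pow_right h))

lemma proj_comp_proj {s t v : ℕ} (h : s ≤ t) (h' : t ≤ v) :
    proj I h' ≫ proj I h = proj I (h.trans h') := by
  ext
  rfl

/-- The transition maps `Ext^i(R ⧸ I ^ s, M) → Ext^i(R ⧸ I ^ t, M)` for `s ≤ t`. -/
noncomputable def transition (i : ℕ) (M : ModuleCat.{u} R) (s t : ℕ) (h : s ≤ t) :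
    Ext (ModuleCat.of R (R ⧸ I ^ s)) M i →ₗ[R] Ext (ModuleCat.of R (R ⧸ I ^ t)) M i where
  toFun x := (Ext.mk₀ (proj I h)).comp x (zero_add i)
  map_add' _ _ := Ext.comp_add ..
  map_smul' _ _ := Ext.comp_smul ..

lemma transition_apply (i : ℕ) (M : ModuleCat.{u} R) {s t : ℕ} (h : s ≤ t)
    (x : Ext (ModuleCat.of R (R ⧸ I ^ s)) M i) :
    transition I i M s t h x = (Ext.mk₀ (proj I h)).comp x (zero_add i) :=
  rfl

instance (i : ℕ) (M : ModuleCat.{u} R) :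
    DirectedSystem (fun t : ℕ => Ext (ModuleCat.of R (R ⧸ I ^ t)) M i)
      (fun s t h => ⇑(transition I i M s t h)) where
  map_self t x := by
    have : proj I (le_refl t) = 𝟙 _ := by ext; rfl
    rw [transition_apply, this, Ext.mk₀_id_comp]
  map_map v t s h h' x := by
    rw [transition_apply, transition_apply, transition_apply, ← proj_comp_proj I h h',
      ← Ext.mk₀_comp_mk₀, Ext.comp_assoc_of_second_deg_zero]

/-- Composition with a fixed extension class, as a linear map. -/
noncomputable def compRight (X : ModuleCat.{u} R) {M N : ModuleCat.{u} R} {i j k : ℕ}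
    (e : Ext M N j) (h : i + j = k) : Ext X M i →ₗ[R] Ext X N k where
  toFun x := x.comp e h
  map_add' _ _ := Ext.add_comp ..
  map_smul' _ _ := Ext.smul_comp ..

lemma compRight_apply (X : ModuleCat.{u} R) {M N : ModuleCat.{u} R} {i j k : ℕ}
    (e : Ext M N j) (h : i + j = k) (x : Ext X M i) : compRight X e h x = x.comp e h :=
  rfl

lemma compRight_transition {M N : ModuleCat.{u} R} {i j k : ℕ}
    (e : Ext M N j) (h : i + j = k) {s t : ℕ} (hst : s ≤ t) :
    compRight _ e h ∘ₗ transition I i M s t hst =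
      transition I k N s t hst ∘ₗ compRight _ e h := by
  ext x
  rw [LinearMap.comp_apply, LinearMap.comp_apply, compRight_apply, compRight_apply,
    transition_apply, transition_apply]
  exact Ext.comp_assoc _ _ _ (zero_add i) h (by omega)

end ExtColimit

open ExtColimit

/-- The direct limit of the modules `Ext^i(R ⧸ I ^ t, M)`. -/
abbrev ExtColimit {R : Type u} [CommRing R] (I : Ideal R) (i : ℕ) (M : Type u)
    [AddCommGroup M] [Module R M] : Type u :=
  Module.DirectLimit
    (fun t : ℕ => Ext (ModuleCat.of R (R ⧸ I ^ t)) (ModuleCat.of R M) i)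
    (transition I i (ModuleCat.of R M))

namespace ExtColimit

variable {R : Type u} [CommRing R] {I : Ideal R} {i : ℕ}
  {M N P : Type u} [AddCommGroup M] [Module R M] [AddCommGroup N] [Module R N]
  [AddCommGroup P] [Module R P]

variable (I i M) in
/-- The canonical map `Ext^i(R ⧸ I ^ t, M) → ExtColimit I i M`. -/
noncomputable def ι (t : ℕ) :
    Ext (ModuleCat.of R (R ⧸ I ^ t)) (ModuleCat.of R M) i →ₗ[R] ExtColimit I i M :=
  Module.DirectLimit.of R ℕ
    (fun t : ℕ => Ext (ModuleCat.of R (R ⧸ I ^ t)) (ModuleCat.of R M) i)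
    (transition I i (ModuleCat.of R M)) t

lemma exists_ι (z : ExtColimit I i M) : ∃ t x, ι I i M t x = z :=
  Module.DirectLimit.exists_of z

lemma ι_transition {s t : ℕ} (h : s ≤ t)
    (x : Ext (ModuleCat.of R (R ⧸ I ^ s)) (ModuleCat.of R M) i) :
    ι I i M t (transition I i _ s t h x) = ι I i M s x :=
  Module.DirectLimit.of_f (f := transition I i (ModuleCat.of R M))

lemma ι_eq_zero {t : ℕ} {x : Ext (ModuleCat.of R (R ⧸ I ^ t)) (ModuleCat.of R M) i}
    (hx : ι I i M t x = 0) : ∃ s h, transition I i _ t s h x = 0 :=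
  Module.DirectLimit.of.zero_exact
    (G := fun t : ℕ => Ext (ModuleCat.of R (R ⧸ I ^ t)) (ModuleCat.of R M) i)
    (f := fun s t h => transition I i (ModuleCat.of R M) s t h) hx

/-- The map on direct limits induced by composition with an extension class. -/
noncomputable def mapOfExt {j k : ℕ} (e : Ext (ModuleCat.of R M) (ModuleCat.of R N) j)
    (h : i + j = k) : ExtColimit I i M →ₗ[R] ExtColimit I k N :=
  Module.DirectLimit.map (fun _ => compRight _ e h)
    (fun _ _ hst => compRight_transition I e h hst)

lemma mapOfExt_ι {j k : ℕ} (e : Ext (ModuleCat.of R M) (ModuleCat.of R N) j)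
    (h : i + j = k) (t : ℕ) (x : Ext (ModuleCat.of R (R ⧸ I ^ t)) (ModuleCat.of R M) i) :
    mapOfExt e h (ι I i M t x) = ι I k N t (x.comp e h) :=
  Module.DirectLimit.map_apply_of (fun _ => compRight _ e h)
    (fun _ _ hst => compRight_transition I e h hst) x

variable (I i) in
/-- Functoriality of `ExtColimit` in the module. -/
noncomputable def map (f : M →ₗ[R] N) : ExtColimit I i M →ₗ[R] ExtColimit I i N :=
  mapOfExt (Ext.mk₀ (ModuleCat.ofHom f)) (add_zero i)

@[simp]
lemma map_ι (f : M →ₗ[R] N) (t : ℕ)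
    (x : Ext (ModuleCat.of R (R ⧸ I ^ t)) (ModuleCat.of R M) i) :
    map I i f (ι I i M t x) =
      ι I i N t (x.comp (Ext.mk₀ (ModuleCat.ofHom f)) (add_zero i)) :=
  mapOfExt_ι ..

lemma map_comp_apply (g : N →ₗ[R] P) (f : M →ₗ[R] N) (x : ExtColimit I i M) :
    map I i (g ∘ₗ f) x = map I i g (map I i f x) := by
  obtain ⟨t, x, rfl⟩ := exists_ι x
  simp [ModuleCat.ofHom_comp, ← Ext.mk₀_comp_mk₀]

lemma map_id_apply (x : ExtColimit I i M) : map I i LinearMap.id x = x := by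
  obtain ⟨t, x, rfl⟩ := exists_ι x
  simp [ModuleCat.ofHom_id]

lemma map_add_apply (f g : M →ₗ[R] N) (x : ExtColimit I i M) :
    map I i (f + g) x = map I i f x + map I i g x := by
  obtain ⟨t, x, rfl⟩ := exists_ι x
  simp [ModuleCat.ofHom_add, Ext.mk₀_add]

lemma map_zero_apply (x : ExtColimit I i M) : map I i (0 : M →ₗ[R] N) x = 0 := by
  obtain ⟨t, x, rfl⟩ := exists_ι x
  simp

lemma map_sum_apply {κ : Type*} (s : Finset κ) (f : κ → M →ₗ[R] N) (x : ExtColimit I i M) :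
    map I i (∑ k ∈ s, f k) x = ∑ k ∈ s, map I i (f k) x := by
  classical
  induction s using Finset.induction_on with
  | empty => simp [map_zero_apply]
  | insert a s ha ih => simp [Finset.sum_insert ha, map_add_apply, ih]

lemma map_smul_id_apply (r : R) (x : ExtColimit I i M) :
    map I i (r • (LinearMap.id : M →ₗ[R] M)) x = r • x := by
  obtain ⟨t, x, rfl⟩ := exists_ι x
  rw [map_ι, ← map_smul, Ext.smul_eq_comp_mk₀]
  rfl

/-- The short complex attached to a pair of composable linear maps with zero composition. -/
abbrev shortComplex {f : M →ₗ[R] N} {g : N →ₗ[R] P} (hfg : Function.Exact f g) :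
    ShortComplex (ModuleCat.{u} R) :=
  ModuleCat.shortComplexOfCompEqZero f g hfg.linearMap_comp_eq_zero

lemma shortComplex_shortExact {f : M →ₗ[R] N} {g : N →ₗ[R] P} (hf : Function.Injective f)
    (hfg : Function.Exact f g) (hg : Function.Surjective g) :
    (shortComplex hfg).ShortExact :=
  ModuleCat.shortComplex_shortExact _ hfg hf hg

variable {f : M →ₗ[R] N} {g : N →ₗ[R] P} (hf : Function.Injective f)
    (hfg : Function.Exact f g) (hg : Function.Surjective g)

/-- The connecting homomorphism. -/
noncomputable def δ (i : ℕ) : ExtColimit I i P →ₗ[R] ExtColimit I (i + 1) M :=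
  mapOfExt (shortComplex_shortExact hf hfg hg).extClass rfl

lemma δ_ι (t : ℕ) (x : Ext (ModuleCat.of R (R ⧸ I ^ t)) (ModuleCat.of R P) i) :
    δ hf hfg hg i (ι I i P t x) =
      ι I (i + 1) M t (x.comp (shortComplex_shortExact hf hfg hg).extClass rfl) :=
  mapOfExt_ι ..

include hf hfg hg in
lemma exact_map_map : Function.Exact (map I i f) (map I i g) := by
  intro y
  constructor
  · intro hy
    obtain ⟨t, y, rfl⟩ := exists_ι y
    rw [map_ι] at hy
    obtain ⟨s, h, hs⟩ := ι_eq_zero hy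
    obtain ⟨x, hx⟩ := Ext.covariant_sequence_exact₂ _ (shortComplex_shortExact hf hfg hg)
      (transition I i _ t s h y) (by
        rw [← hs]; exact Ext.comp_assoc_of_third_deg_zero _ _ _ (zero_add _))
    refine ⟨ι I i M s x, ?_⟩
    rw [map_ι, ← ι_transition h]
    exact congrArg _ hx
  · rintro ⟨x, rfl⟩
    rw [← map_comp_apply, hfg.linearMap_comp_eq_zero, map_zero_apply]

lemma exact_map_δ : Function.Exact (map I i g) (δ hf hfg hg i) := by
  intro y
  constructor
  · intro hy
    obtain ⟨t, y, rfl⟩ := exists_ι y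
    rw [δ_ι] at hy
    obtain ⟨s, h, hs⟩ := ι_eq_zero hy
    obtain ⟨x, hx⟩ := Ext.covariant_sequence_exact₃ _ (shortComplex_shortExact hf hfg hg)
      (transition I i _ t s h y) rfl (by
        rw [← hs]; exact Ext.comp_assoc _ _ _ (zero_add i) rfl (by omega))
    refine ⟨ι I i N s x, ?_⟩
    rw [map_ι, ← ι_transition h]
    exact congrArg _ hx
  · rintro ⟨x, rfl⟩
    obtain ⟨t, x, rfl⟩ := exists_ι x
    rw [map_ι, δ_ι, Ext.comp_assoc_of_second_deg_zero]
    have := (shortComplex_shortExact hf hfg hg).comp_extClass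
    dsimp at this
    erw [this]
    simp

lemma exact_δ_map : Function.Exact (δ (I := I) hf hfg hg i) (map I (i + 1) f) := by
  intro y
  constructor
  · intro hy
    obtain ⟨t, y, rfl⟩ := exists_ι y
    rw [map_ι] at hy
    obtain ⟨s, h, hs⟩ := ι_eq_zero hy
    obtain ⟨x, hx⟩ := Ext.covariant_sequence_exact₁ _ (shortComplex_shortExact hf hfg hg)
      (transition I _ _ t s h y) (by
        rw [← hs]; exact Ext.comp_assoc_of_third_deg_zero _ _ _ (zero_add _)) rfl
    refine ⟨ι I i P s x, ?_⟩
    rw [δ_ι, ← ι_transition h]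
    exact congrArg _ hx
  · rintro ⟨x, rfl⟩
    obtain ⟨t, x, rfl⟩ := exists_ι x
    rw [δ_ι, map_ι, Ext.comp_assoc_of_third_deg_zero]
    have := (shortComplex_shortExact hf hfg hg).extClass_comp
    dsimp at this
    erw [this]
    simp

end ExtColimit

/-- Every element of `M` is annihilated by a power of `I`. -/
def IsPowTorsion {R : Type*} [CommRing R] (I : Ideal R) (M : Type*) [AddCommGroup M]
    [Module R M] : Prop :=
  ∀ m : M, ∃ t : ℕ, ∀ a ∈ I ^ t, a • m = 0

/-- The submodule of elements annihilated by a power of `I`. -/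
def powTorsion {R : Type*} [CommRing R] (I : Ideal R) (M : Type*) [AddCommGroup M]
    [Module R M] : Submodule R M where
  carrier := {m | ∃ t : ℕ, ∀ a ∈ I ^ t, a • m = 0}
  zero_mem' := ⟨0, by simp⟩
  add_mem' := by
    rintro x y ⟨s, hs⟩ ⟨t, ht⟩
    refine ⟨s + t, fun a ha => ?_⟩
    rw [smul_add, hs a (Ideal.pow_le_pow_right (by omega) ha),
      ht a (Ideal.pow_le_pow_right (by omega) ha), add_zero]
  smul_mem' := by
    rintro c x ⟨s, hs⟩
    exact ⟨s, fun a ha => by rw [smul_comm, hs a ha, smul_zero]⟩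

section PowTorsion

variable {R : Type u} [CommRing R] {I : Ideal R} {M N : Type u} [AddCommGroup M] [Module R M]
  [AddCommGroup N] [Module R N]

lemma isPowTorsion_powTorsion : IsPowTorsion I (powTorsion I M) := by
  rintro ⟨m, t, ht⟩
  exact ⟨t, fun a ha => Subtype.ext (ht a ha)⟩

lemma IsPowTorsion.of_surjective (h : IsPowTorsion I M) {f : M →ₗ[R] N}
    (hf : Function.Surjective f) : IsPowTorsion I N := by
  intro n
  obtain ⟨m, rfl⟩ := hf n
  obtain ⟨t, ht⟩ := h m
  exact ⟨t, fun a ha => by rw [← map_smul, ht a ha, map_zero]⟩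

lemma IsPowTorsion.exists_pow_of_fg (h : IsPowTorsion I M) [Module.Finite R N]
    (f : N →ₗ[R] M) : ∃ t : ℕ, ∀ a ∈ I ^ t, ∀ x, a • f x = 0 := by
  obtain ⟨s, hs⟩ := (Module.Finite.fg_top (R := R) (M := N))
  choose T hT using h
  refine ⟨s.sup (fun x => T (f x)), fun a ha x => ?_⟩
  have hx : x ∈ Submodule.span R (s : Set N) := hs ▸ Submodule.mem_top
  induction hx using Submodule.span_induction with
  | mem y hy =>
    exact hT _ a (Ideal.pow_le_pow_right (Finset.le_sup (f := fun x => T (f x)) hy) ha)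
  | zero => simp
  | add y z _ _ hy hz => rw [map_add, smul_add, hy, hz, add_zero]
  | smul c y _ hy => rw [map_smul, smul_comm, hy, smul_zero]

lemma injective_powTorsion [IsNoetherianRing R] (h : Module.Injective R M) :
    Module.Injective R (powTorsion I M) := by
  refine Module.Baer.injective fun A g => ?_
  obtain ⟨t, ht⟩ := (isPowTorsion_powTorsion (I := I) (M := M)).exists_pow_of_fg g
  obtain ⟨k, hk⟩ := Ideal.exists_pow_inf_eq_pow_smul I A
  have hg : ∀ x : A, (x : R) ∈ I ^ (t + k) → g x = 0 := by
    rintro ⟨x, hxA⟩ hx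
    have h1 : x ∈ (I ^ (t + k) • ⊤ : Submodule R R) ⊓ A := ⟨by simpa using hx, hxA⟩
    rw [hk (t + k) (by omega), Nat.add_sub_cancel] at h1
    have h2 : x ∈ (I ^ t) • A := Submodule.smul_mono le_rfl inf_le_right h1
    have key : ∀ y ∈ (I ^ t) • A, ∃ hy : y ∈ A, g ⟨y, hy⟩ = 0 := by
      intro y hy
      refine Submodule.smul_induction_on hy ?_ ?_
      · intro r hr n hn
        refine ⟨A.smul_mem r hn, ?_⟩
        rw [← ht r hr ⟨n, hn⟩, ← map_smul]
        rfl
      · rintro y z ⟨hy, hy'⟩ ⟨hz, hz'⟩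
        refine ⟨A.add_mem hy hz, ?_⟩
        rw [← add_zero (0 : powTorsion I M)]
        nth_rewrite 1 [← hy']
        rw [← hz', ← map_add]
        rfl
    exact (key x h2).2
  set s := t + k with hs
  let B : Submodule R A := Submodule.comap (Submodule.subtype A) (I ^ s : Ideal R)
  let e : (A ⧸ B) →ₗ[R] (R ⧸ I ^ s) := Submodule.mapQ _ _ (Submodule.subtype A) le_rfl
  have he : Function.Injective e := by
    rw [← LinearMap.ker_eq_bot]
    exact Submodule.ker_liftQ_eq_bot _ _ _ (fun x hx => by
      simpa [B, Ideal.Quotient.eq_zero_iff_mem] using hx)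
  let g' : (A ⧸ B) →ₗ[R] M := Submodule.liftQ _ ((powTorsion I M).subtype ∘ₗ g)
    (fun x hx => by simp [hg x hx])
  obtain ⟨φ, hφ⟩ := h.out e he g'
  let ψ : R →ₗ[R] M := φ ∘ₗ Submodule.mkQ _
  refine ⟨ψ.codRestrict _ fun r => ⟨s, fun a ha => ?_⟩, fun x hx => Subtype.ext ?_⟩
  · rw [← map_smul]
    have : Submodule.mkQ (I ^ s) (a • r) = 0 := by
      rw [Submodule.mkQ_apply, Submodule.Quotient.mk_eq_zero]
      exact Ideal.mul_mem_right _ _ ha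
    simp only [ψ, LinearMap.comp_apply, this, map_zero]
  · exact hφ (Submodule.Quotient.mk ⟨x, hx⟩)

end PowTorsion

namespace ExtColimit

variable {R : Type u} [CommRing R] {I : Ideal R} {i : ℕ}
  {M N P : Type u} [AddCommGroup M] [Module R M] [AddCommGroup N] [Module R N]
  [AddCommGroup P] [Module R P]

lemma smul_eq_zero_of_annihilates {r : R} (hr : ∀ m : M, r • m = 0) (x : ExtColimit I i M) :
    r • x = 0 := by
  rw [← map_smul_id_apply, show r • (LinearMap.id : M →ₗ[R] M) = 0 from LinearMap.ext hr,
    map_zero_apply]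

variable (I i M) in
lemma isPowTorsion : IsPowTorsion I (ExtColimit I i M) := by
  intro z
  obtain ⟨t, x, rfl⟩ := exists_ι z
  refine ⟨t, fun a ha => ?_⟩
  have h : a • 𝟙 (ModuleCat.of R (R ⧸ I ^ t)) = 0 := by
    ext : 1
    refine LinearMap.ext fun y => ?_
    obtain ⟨y, rfl⟩ := Submodule.Quotient.mk_surjective _ y
    change Submodule.Quotient.mk (a • y) = 0
    rw [Submodule.Quotient.mk_eq_zero]
    exact Ideal.mul_mem_right _ _ ha
  have h' : a • x = (Ext.mk₀ (a • 𝟙 (ModuleCat.of R (R ⧸ I ^ t)))).comp x (zero_add i) := by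
    simp [Ext.mk₀_smul]
  rw [← map_smul, h', h]
  simp

lemma subsingleton_of_injective (h : Module.Injective R M) :
    Subsingleton (ExtColimit I (i + 1) M) := by
  refine subsingleton_of_forall_eq 0 fun z => ?_
  obtain ⟨t, x, rfl⟩ := exists_ι z
  have := Module.injective_object_of_injective_module R M
  rw [Ext.eq_zero_of_injective x, map_zero]

/-- The homomorphism `R ⧸ I ^ t → M` given by an element killed by `I ^ t`. -/
def torsionHom {t : ℕ} {m : M} (h : ∀ a ∈ I ^ t, a • m = 0) :
    ModuleCat.of R (R ⧸ I ^ t) ⟶ ModuleCat.of R M :=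
  ModuleCat.ofHom (Submodule.liftQ _ (LinearMap.toSpanSingleton R M m) h)

lemma torsionHom_apply {t : ℕ} {m : M} (h : ∀ a ∈ I ^ t, a • m = 0) (r : R) :
    torsionHom h (Submodule.Quotient.mk r) = r • m := rfl

/-- The element of `ExtColimit I 0 M` given by an element killed by a power of `I`. -/
noncomputable def ofTorsion {t : ℕ} {m : M} (h : ∀ a ∈ I ^ t, a • m = 0) : ExtColimit I 0 M :=
  ι I 0 M t (Ext.mk₀ (torsionHom h))

lemma exists_ofTorsion (z : ExtColimit I 0 M) :
    ∃ (t : ℕ) (m : M) (h : ∀ a ∈ I ^ t, a • m = 0), ofTorsion h = z := by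
  obtain ⟨t, x, rfl⟩ := exists_ι z
  obtain ⟨φ, rfl⟩ := (Ext.mk₀_bijective _ _).2 x
  have h : ∀ a ∈ I ^ t, a • φ (Submodule.Quotient.mk 1) = 0 := fun a ha => by
    rw [← map_smul, ← Submodule.Quotient.mk_smul, (Submodule.Quotient.mk_eq_zero _).2
      (by simpa using ha), map_zero]
  refine ⟨t, φ (Submodule.Quotient.mk 1), h, ?_⟩
  have : torsionHom h = φ := by
    ext : 1
    refine LinearMap.ext fun y => ?_
    obtain ⟨y, rfl⟩ := Submodule.Quotient.mk_surjective _ y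
    refine (torsionHom_apply h y).trans ?_
    rw [← map_smul, ← Submodule.Quotient.mk_smul, smul_eq_mul, mul_one]
  rw [ofTorsion, this]

lemma transition_torsionHom {s t : ℕ} (hst : s ≤ t) {m : M} (h : ∀ a ∈ I ^ s, a • m = 0) :
    transition I 0 _ s t hst (Ext.mk₀ (torsionHom h)) =
      Ext.mk₀ (torsionHom fun a ha => h a (Ideal.pow_le_pow_right hst ha)) := by
  rw [transition_apply, Ext.mk₀_comp_mk₀]
  congr 1
  ext : 1
  refine LinearMap.ext fun y => ?_
  obtain ⟨y, rfl⟩ := Submodule.Quotient.mk_surjective _ y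
  rfl

lemma eq_zero_of_ofTorsion_eq_zero {t : ℕ} {m : M} (h : ∀ a ∈ I ^ t, a • m = 0)
    (h0 : ofTorsion h = 0) : m = 0 := by
  obtain ⟨s, hts, hs⟩ := ι_eq_zero h0
  rw [transition_torsionHom, Ext.mk₀_eq_zero_iff] at hs
  have := torsionHom_apply (fun a ha => h a (Ideal.pow_le_pow_right hts ha)) 1
  rw [hs] at this
  simpa using this.symm

lemma eq_zero_of_subsingleton (h : Subsingleton (ExtColimit I 0 M)) {t : ℕ} {m : M}
    (hm : ∀ a ∈ I ^ t, a • m = 0) : m = 0 :=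
  eq_zero_of_ofTorsion_eq_zero hm (Subsingleton.elim _ _)

lemma map_surjective_zero (h : IsPowTorsion I M) {f : M →ₗ[R] N}
    (hf : Function.Surjective f) : Function.Surjective (map I 0 f) := by
  intro z
  obtain ⟨t, n, hn, rfl⟩ := exists_ofTorsion z
  obtain ⟨m, rfl⟩ := hf n
  obtain ⟨s, hs⟩ := h m
  have hst : ∀ a ∈ I ^ (max s t), a • m = 0 := fun a ha =>
    hs a (Ideal.pow_le_pow_right (le_max_left _ _) ha)
  refine ⟨ofTorsion hst, ?_⟩
  rw [ofTorsion, ofTorsion, map_ι, Ext.mk₀_comp_mk₀, ← ι_transition (le_max_right s t),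
    transition_torsionHom]
  congr 2
  ext : 1
  refine LinearMap.ext fun y => ?_
  obtain ⟨y, rfl⟩ := Submodule.Quotient.mk_surjective _ y
  exact map_smul f y m

section Subsingleton

lemma subsingleton_of_equiv (e : M ≃ₗ[R] N) (h : Subsingleton (ExtColimit I i M)) :
    Subsingleton (ExtColimit I i N) := by
  refine subsingleton_of_forall_eq 0 fun z => ?_
  rw [← map_id_apply z, ← e.comp_symm, map_comp_apply, Subsingleton.elim (map I i _ z) 0,
    map_zero]

/-- A linear equivalence induces one on `ExtColimit`. -/
noncomputable def mapEquiv (e : M ≃ₗ[R] N) : ExtColimit I i M ≃ₗ[R] ExtColimit I i N :=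
  LinearEquiv.ofLinearMap (map I i e.toLinearMap) (map I i e.symm.toLinearMap)
    (LinearMap.ext fun x => by
      rw [LinearMap.comp_apply, ← map_comp_apply, e.comp_symm, map_id_apply, LinearMap.id_apply])
    (LinearMap.ext fun x => by
      rw [LinearMap.comp_apply, ← map_comp_apply, e.symm_comp, map_id_apply, LinearMap.id_apply])

variable {f : M →ₗ[R] N} {g : N →ₗ[R] P} (hf : Function.Injective f)
    (hfg : Function.Exact f g) (hg : Function.Surjective g)

include hf hfg hg

lemma subsingleton_mid (h₁ : Subsingleton (ExtColimit I i M))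
    (h₃ : Subsingleton (ExtColimit I i P)) : Subsingleton (ExtColimit I i N) := by
  refine subsingleton_of_forall_eq 0 fun z => ?_
  obtain ⟨y, rfl⟩ := (exact_map_map hf hfg hg z).1 (Subsingleton.elim _ _)
  rw [Subsingleton.elim y 0, map_zero]

lemma subsingleton_right (h₂ : Subsingleton (ExtColimit I i N))
    (h₁ : Subsingleton (ExtColimit I (i + 1) M)) : Subsingleton (ExtColimit I i P) := by
  refine subsingleton_of_forall_eq 0 fun z => ?_
  obtain ⟨y, rfl⟩ := (exact_map_δ hf hfg hg z).1 (Subsingleton.elim _ _)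
  rw [Subsingleton.elim y 0, map_zero]

lemma subsingleton_left (h₃ : Subsingleton (ExtColimit I i P))
    (h₂ : Subsingleton (ExtColimit I (i + 1) N)) : Subsingleton (ExtColimit I (i + 1) M) := by
  refine subsingleton_of_forall_eq 0 fun z => ?_
  obtain ⟨y, rfl⟩ := (exact_δ_map hf hfg hg z).1 (Subsingleton.elim _ _)
  rw [Subsingleton.elim y 0, map_zero]

lemma map_surjective_of_subsingleton (h : Subsingleton (ExtColimit I (i + 1) M)) :
    Function.Surjective (map I i g) := fun z =>
  (exact_map_δ hf hfg hg z).1 (Subsingleton.elim _ _)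

end Subsingleton

lemma exists_injective_isPowTorsion [IsNoetherianRing R] (h : IsPowTorsion I M) :
    ∃ (J : Type u) (_ : AddCommGroup J) (_ : Module R J) (f : M →ₗ[R] J),
      Module.Injective R J ∧ IsPowTorsion I J ∧ Function.Injective f := by
  obtain ⟨J, _, f₀, _⟩ := (EnoughInjectives.presentation (ModuleCat.of R M)).some
  let f : M →ₗ[R] powTorsion I J := f₀.hom.codRestrict _ fun m => by
    obtain ⟨t, ht⟩ := h m
    exact ⟨t, fun a ha => by rw [← map_smul, ht a ha, map_zero]⟩
  refine ⟨powTorsion I J, inferInstance, inferInstance, f,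
    injective_powTorsion (Module.injective_module_of_injective_object R J),
    isPowTorsion_powTorsion, (LinearMap.injective_codRestrict_iff ..).2 ?_⟩
  exact (ModuleCat.mono_iff_injective f₀).1 inferInstance

/-- Power torsion modules have no higher cohomology. -/
lemma subsingleton_of_isPowTorsion [IsNoetherianRing R] (i : ℕ) (h : IsPowTorsion I M) :
    Subsingleton (ExtColimit I (i + 1) M) := by
  induction i generalizing M with
  | zero =>
    obtain ⟨J, _, _, f, hJ, hJ', hf⟩ := exists_injective_isPowTorsion h
    have hs := map_surjective_zero hJ' (Submodule.mkQ_surjective (LinearMap.range f))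
    have hJ1 : Subsingleton (ExtColimit I (0 + 1) J) := subsingleton_of_injective hJ
    refine subsingleton_of_forall_eq 0 fun z => ?_
    obtain ⟨y, rfl⟩ := (exact_δ_map hf f.exact_map_mkQ_range
      (Submodule.mkQ_surjective _) z).1 (Subsingleton.elim _ _)
    obtain ⟨w, rfl⟩ := hs y
    exact (exact_map_δ hf f.exact_map_mkQ_range (Submodule.mkQ_surjective _) _).2 ⟨w, rfl⟩
  | succ i ih =>
    obtain ⟨J, _, _, f, hJ, hJ', hf⟩ := exists_injective_isPowTorsion h
    exact subsingleton_left hf f.exact_map_mkQ_range (Submodule.mkQ_surjective _)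
      (ih (hJ'.of_surjective (Submodule.mkQ_surjective _))) (subsingleton_of_injective hJ)

end ExtColimit

namespace ExtColimit

variable {R : Type u} [CommRing R] {I : Ideal R} {i : ℕ}
  {M N P : Type u} [AddCommGroup M] [Module R M] [AddCommGroup N] [Module R N]
  [AddCommGroup P] [Module R P]

/-- The cohomology vanishes when an element of `I` acts invertibly. -/
lemma subsingleton_of_isUnit {g : R} (hg : g ∈ I)
    (h : IsUnit (algebraMap R (Module.End R M) g)) : Subsingleton (ExtColimit I i M) := by
  obtain ⟨u, hu⟩ := h
  have key : ∀ z : ExtColimit I i M, g • z = 0 → z = 0 := fun z hz => by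
    have h1 : (↑u⁻¹ : Module.End R M) ∘ₗ (g • LinearMap.id) = LinearMap.id := by
      have : g • (LinearMap.id : M →ₗ[R] M) = u := by
        rw [hu]; rfl
      rw [this]
      exact u.inv_mul
    rw [← map_id_apply z, ← h1, map_comp_apply, map_smul_id_apply, hz, map_zero]
  have key' : ∀ (t : ℕ) (z : ExtColimit I i M), g ^ t • z = 0 → z = 0 := by
    intro t
    induction t with
    | zero => intro z hz; simpa using hz
    | succ t ih =>
      intro z hz
      rw [pow_succ, mul_smul] at hz
      exact key z (ih _ hz)
  refine subsingleton_of_forall_eq 0 fun z => ?_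
  obtain ⟨t, ht⟩ := isPowTorsion I i M z
  exact key' t z (ht _ (Ideal.pow_mem_pow hg t))

lemma le_radical_of_cons {A B : Ideal R} {g : R} {gs : List R} (hA : A ≤ B) {k : ℕ}
    (hg : g ^ k ∈ B) (h : I ≤ (A ⊔ Ideal.ofList (g :: gs)).radical) :
    I ≤ (B ⊔ Ideal.ofList gs).radical := by
  refine h.trans (Ideal.radical_le_radical_iff.2 ?_)
  rw [Ideal.ofList_cons]
  refine sup_le ((hA.trans le_sup_left).trans Ideal.le_radical) (sup_le ?_
    (le_sup_right.trans Ideal.le_radical))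
  rw [Ideal.span_singleton_le_iff_mem]
  exact ⟨k, Ideal.mem_sup_left hg⟩

/-- Cohomology vanishes above the number of elements generating `I` up to radical modulo
annihilators of elements. -/
lemma subsingleton_of_length_lt [IsNoetherianRing R] (gs : List R) (hgs : ∀ g ∈ gs, g ∈ I)
    (hM : ∀ m : M, I ≤ (Ideal.torsionOf R M m ⊔ Ideal.ofList gs).radical)
    (hi : gs.length < i) : Subsingleton (ExtColimit I i M) := by
  induction gs generalizing M i with
  | nil =>
    obtain ⟨i, rfl⟩ : ∃ k, i = k + 1 := ⟨i - 1, by simp at hi; omega⟩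
    refine subsingleton_of_isPowTorsion i fun m => ?_
    obtain ⟨t, ht⟩ := Ideal.exists_pow_le_of_le_radical_of_fg
      (J := Ideal.torsionOf R M m) (by simpa using hM m) (IsNoetherian.noetherian I)
    exact ⟨t, fun a ha => ht ha⟩
  | cons g gs ih =>
    obtain ⟨i, rfl⟩ : ∃ k, i = k + 1 := ⟨i - 1, by simp at hi; omega⟩
    have hi' : gs.length < i := by simpa using hi
    have hgI : g ∈ I := hgs g (by simp)
    have ih' := fun {M : Type u} [AddCommGroup M] [Module R M] {i : ℕ} =>
      @ih i M _ _ (fun x hx => hgs x (by simp [hx]))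
    let S := Submonoid.powers g
    let L := LocalizedModule S M
    let f : M →ₗ[R] L := LocalizedModule.mkLinearMap S M
    have hL : ∀ j, Subsingleton (ExtColimit I j L) := fun j =>
      subsingleton_of_isUnit hgI
        (IsLocalizedModule.map_units f (⟨g, Submonoid.mem_powers g⟩ : S))
    have hK : Subsingleton (ExtColimit I (i + 1) (LinearMap.ker f)) := by
      refine ih' (fun m => ?_) (by omega)
      obtain ⟨_, ⟨k, rfl⟩, hk⟩ := LocalizedModule.mem_ker_mkLinearMap_iff.1 m.2
      refine le_radical_of_cons (A := Ideal.torsionOf R M m) (g := g) (k := k)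
        (fun a ha => ?_) ?_ (hM m)
      · rw [Ideal.mem_torsionOf_iff] at ha ⊢
        exact Subtype.ext ha
      · rw [Ideal.mem_torsionOf_iff]
        exact Subtype.ext hk
    have hQ : Subsingleton (ExtColimit I i (L ⧸ LinearMap.range f)) := by
      refine ih' (fun q => ?_) hi'
      obtain ⟨l, rfl⟩ := Submodule.Quotient.mk_surjective _ q
      obtain ⟨⟨m, ⟨s, k, hs⟩⟩, hm⟩ := IsLocalizedModule.surj S f l
      replace hm : g ^ k • l = f m := by
        rw [← hm]; subst hs; rfl
      refine le_radical_of_cons (A := Ideal.torsionOf R M m) (g := g) (k := k)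
        (fun a ha => ?_) ?_ (hM m)
      · rw [Ideal.mem_torsionOf_iff] at ha ⊢
        have : a • l = 0 := by
          have hu := IsLocalizedModule.map_units f (⟨g ^ k, k, rfl⟩ : S)
          apply (Module.End.isUnit_iff _).1 hu |>.1
          rw [map_zero]
          change g ^ k • a • l = 0
          rw [smul_comm, hm, ← map_smul, ha, map_zero]
        rw [← Submodule.Quotient.mk_smul, this, Submodule.Quotient.mk_zero]
      · rw [Ideal.mem_torsionOf_iff, ← Submodule.Quotient.mk_smul, hm,
          Submodule.Quotient.mk_eq_zero]
        exact LinearMap.mem_range_self f m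
    have hR : Subsingleton (ExtColimit I (i + 1) (LinearMap.range f)) :=
      subsingleton_left (Submodule.injective_subtype _)
        (LinearMap.exact_subtype_mkQ _)
        (Submodule.mkQ_surjective _) hQ (hL _)
    refine subsingleton_mid (f := (LinearMap.ker f).subtype) (g := f.rangeRestrict)
      (Submodule.injective_subtype _) ?_ f.surjective_rangeRestrict hK hR
    intro x
    simp [Subtype.ext_iff]

/-- Multiplication by `x` on `R ⧸ J` and the projection to `R ⧸ (J ⊔ (x))`. -/
lemma exact_lsmul_factor (J : Ideal R) (x : R) :
    Function.Exact (LinearMap.lsmul R (R ⧸ J) x)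
      (Submodule.factor (le_sup_left : J ≤ J ⊔ Ideal.span {x})) := by
  intro y
  obtain ⟨y, rfl⟩ := Submodule.Quotient.mk_surjective _ y
  have h0 : Submodule.factor (le_sup_left : J ≤ J ⊔ Ideal.span {x}) (Submodule.Quotient.mk y) =
    Submodule.Quotient.mk y := rfl
  rw [h0, Submodule.Quotient.mk_eq_zero]
  constructor
  · intro h
    obtain ⟨a, ha, b, hb, rfl⟩ := Submodule.mem_sup.1 h
    obtain ⟨c, rfl⟩ := Ideal.mem_span_singleton'.1 hb
    refine ⟨Submodule.Quotient.mk c, ?_⟩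
    rw [LinearMap.lsmul_apply, ← Submodule.Quotient.mk_smul, Submodule.Quotient.mk_add,
      (Submodule.Quotient.mk_eq_zero J).2 ha, zero_add, smul_eq_mul, mul_comm]
  · rintro ⟨z, hz⟩
    obtain ⟨z, rfl⟩ := Submodule.Quotient.mk_surjective _ z
    rw [LinearMap.lsmul_apply, ← Submodule.Quotient.mk_smul, Submodule.Quotient.eq] at hz
    rw [← sub_sub_cancel (x • z) y]
    exact sub_mem (Ideal.mem_sup_right (Ideal.mem_span_singleton.2 ⟨z, rfl⟩))
      (Ideal.mem_sup_left hz)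

lemma eq_top_of_forall_subsingleton [IsNoetherianRing R] [IsLocalRing R] (hI : I ≠ ⊤)
    (J : Ideal R) (h : ∀ i, Subsingleton (ExtColimit I i (R ⧸ J))) : J = ⊤ := by
  by_contra hJ
  obtain ⟨J, ⟨hJ, h⟩, hmax⟩ := set_has_maximal_iff_noetherian.2 ‹IsNoetherian R R›
    {J : Ideal R | J ≠ ⊤ ∧ ∀ i, Subsingleton (ExtColimit I i (R ⧸ J))} ⟨J, hJ, h⟩
  have h0 : Subsingleton ((R ⧸ I) →ₗ[R] (R ⧸ J)) := by
    refine subsingleton_of_forall_eq 0 fun φ => LinearMap.ext fun y => ?_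
    obtain ⟨y, rfl⟩ := Submodule.Quotient.mk_surjective _ y
    refine eq_zero_of_subsingleton (h 0) (t := 1) fun a ha => ?_
    have hy : (Submodule.Quotient.mk (a • y) : R ⧸ I) = 0 :=
      (Submodule.Quotient.mk_eq_zero _).2 (I.mul_mem_right _ (by simpa using ha))
    rw [← map_smul, ← Submodule.Quotient.mk_smul, hy, map_zero]
  obtain ⟨x, hx, hxr⟩ := IsSMulRegular.subsingleton_linearMap_iff.1 h0
  rw [Ideal.annihilator_quotient] at hx
  have hne : J ⊔ Ideal.span {x} ≠ ⊤ := by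
    have : J ⊔ Ideal.span {x} ≤ IsLocalRing.maximalIdeal R :=
      sup_le (IsLocalRing.le_maximalIdeal hJ)
        ((Ideal.span_singleton_le_iff_mem _).2 (IsLocalRing.le_maximalIdeal hI hx))
    exact fun e => (Ideal.IsMaximal.ne_top inferInstance) (top_le_iff.1 (e ▸ this))
  have := hmax (J ⊔ Ideal.span {x}) ⟨hne, fun i =>
    subsingleton_right (f := LinearMap.lsmul R (R ⧸ J) x) hxr (exact_lsmul_factor J x)
      (Submodule.factor_surjective _) (h i) (h (i + 1))⟩
  have hxJ : x ∈ J := by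
    by_contra hxJ
    refine this (lt_of_le_of_ne le_sup_left fun e => hxJ ?_)
    rw [e]
    exact Ideal.mem_sup_right (Ideal.mem_span_singleton_self x)
  refine hJ ((Ideal.eq_top_iff_one _).2 ?_)
  rw [← Submodule.Quotient.mk_eq_zero]
  apply hxr
  change x • _ = x • 0
  rw [smul_zero, ← Submodule.Quotient.mk_smul, Submodule.Quotient.mk_eq_zero]
  simpa using hxJ

lemma smul_eq_zero_of_pi {k : ℕ} {a : R} (h : ∀ z : ExtColimit I i M, a • z = 0)
    (z : ExtColimit I i (Fin k → M)) : a • z = 0 := by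
  have : (LinearMap.id : (Fin k → M) →ₗ[R] (Fin k → M)) =
      ∑ j, LinearMap.single R (fun _ => M) j ∘ₗ LinearMap.proj j := by
    ext j m l
    simp [Pi.single_apply]
  rw [← map_id_apply z, this, map_sum_apply, Finset.smul_sum]
  refine Finset.sum_eq_zero fun j _ => ?_
  rw [map_comp_apply, ← map_smul, h, map_zero]

lemma exists_pi_surjective [Module.Finite R N] (J : Ideal R)
    (hN : ∀ a ∈ J, ∀ x : N, a • x = 0) :
    ∃ (k : ℕ) (π : (Fin k → R ⧸ J) →ₗ[R] N), Function.Surjective π := by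
  obtain ⟨k, f, hf⟩ := Module.Finite.exists_fin' R N
  refine ⟨k, LinearMap.lsum R (fun _ => R ⧸ J) R fun j =>
    Submodule.liftQ J (LinearMap.toSpanSingleton R N (f (Pi.single j 1)))
      fun a ha => hN a ha _, fun n => ?_⟩
  obtain ⟨v, rfl⟩ := hf n
  refine ⟨fun j => Submodule.Quotient.mk (v j), ?_⟩
  rw [LinearMap.lsum_apply]
  simp only [LinearMap.sum_apply, LinearMap.comp_apply, LinearMap.proj_apply]
  conv_rhs => rw [pi_eq_sum_univ' v]
  simp only [map_sum, map_smul]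
  rfl

lemma exists_bound [IsNoetherianRing R] (I : Ideal R) : ∃ D : ℕ, ∀ i, D < i →
    ∀ (M : Type u) [AddCommGroup M] [Module R M], Subsingleton (ExtColimit I i M) := by
  obtain ⟨s, hs⟩ := IsNoetherian.noetherian I
  have h : Ideal.ofList s.toList = I := by
    rw [← hs, Ideal.ofList]
    simp
  refine ⟨s.toList.length, fun i hi M _ _ => subsingleton_of_length_lt s.toList
    (fun g hg => h ▸ Ideal.subset_span hg) (fun m => ?_) hi⟩
  rw [h]
  exact le_sup_right.trans Ideal.le_radical

lemma subsingleton_of_gt [IsNoetherianRing R] {J : Ideal R} {n : ℕ}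
    (h : ∀ i, n < i → Subsingleton (ExtColimit I i (R ⧸ J))) (hi : n < i)
    [Module.Finite R N] (hN : ∀ a ∈ J, ∀ x : N, a • x = 0) :
    Subsingleton (ExtColimit I i N) := by
  obtain ⟨D, hD⟩ := exists_bound I
  obtain ⟨k, hk⟩ : ∃ k, D < i + k := ⟨D + 1, by omega⟩
  induction k generalizing i N with
  | zero => exact hD i (by omega) N
  | succ k ih =>
    obtain ⟨m, π, hπ⟩ := exists_pi_surjective J hN
    refine subsingleton_right (f := (LinearMap.ker π).subtype) (g := π)
      (Submodule.injective_subtype _) (LinearMap.exact_subtype_ker_map π) hπ ?_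
      (ih (by omega) (fun a ha x => ?_) (by omega))
    · have := h i hi
      refine subsingleton_of_forall_eq 0 fun z => ?_
      simpa using smul_eq_zero_of_pi (a := (1 : R)) (fun z => Subsingleton.elim _ _) z
    · refine Subtype.ext (funext fun j => ?_)
      obtain ⟨r, hr⟩ := Submodule.Quotient.mk_surjective _ (x.1 j)
      change a • x.1 j = 0
      rw [← hr, ← Submodule.Quotient.mk_smul, Submodule.Quotient.mk_eq_zero]
      exact J.mul_mem_right _ ha

end ExtColimit

namespace ExtColimit

variable {R : Type u} [CommRing R] {I : Ideal R} {i : ℕ}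
  {M N P : Type u} [AddCommGroup M] [Module R M] [AddCommGroup N] [Module R N]
  [AddCommGroup P] [Module R P]

lemma map_lsmul_apply (r : R) (z : ExtColimit I i M) :
    map I i (LinearMap.lsmul R M r) z = r • z := by
  rw [← map_smul_id_apply]
  rfl

lemma smul_quotient_eq_zero {J : Ideal R} {a : R} (ha : a ∈ J) (x : R ⧸ J) : a • x = 0 := by
  obtain ⟨r, rfl⟩ := Submodule.Quotient.mk_surjective _ x
  rw [← Submodule.Quotient.mk_smul, Submodule.Quotient.mk_eq_zero]
  exact J.mul_mem_right _ ha

lemma smul_ofTorsion {t : ℕ} {m : M} (h : ∀ a ∈ I ^ t, a • m = 0) (r : R)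
    (h' : ∀ a ∈ I ^ t, a • r • m = 0) : r • ofTorsion h = ofTorsion h' := by
  rw [ofTorsion, ofTorsion, ← map_smul, ← Ext.mk₀_smul]
  congr 2
  ext : 1
  refine LinearMap.ext fun y => ?_
  obtain ⟨y, rfl⟩ := Submodule.Quotient.mk_surjective _ y
  exact smul_comm r y m

lemma map_ofTorsion (f : M →ₗ[R] N) {t : ℕ} {m : M} (h : ∀ a ∈ I ^ t, a • m = 0)
    (h' : ∀ a ∈ I ^ t, a • f m = 0) : map I 0 f (ofTorsion h) = ofTorsion h' := by
  rw [ofTorsion, ofTorsion, map_ι, Ext.mk₀_comp_mk₀]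
  congr 2
  ext : 1
  refine LinearMap.ext fun y => ?_
  obtain ⟨y, rfl⟩ := Submodule.Quotient.mk_surjective _ y
  exact map_smul f y m

lemma ofTorsion_eq_zero {t : ℕ} {m : M} (h : ∀ a ∈ I ^ t, a • m = 0) (hm : m = 0) :
    ofTorsion h = 0 := by
  subst hm
  rw [ofTorsion]
  convert! map_zero (ι I 0 M t)
  rw [Ext.mk₀_eq_zero_iff]
  ext : 1
  refine LinearMap.ext fun y => ?_
  obtain ⟨y, rfl⟩ := Submodule.Quotient.mk_surjective _ y
  exact smul_zero y

lemma smul_eq_zero_of_le [IsNoetherianRing R] {J : Ideal R} {n : ℕ}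
    (h : ∀ i, i ≠ n → Subsingleton (ExtColimit I i (R ⧸ J))) {a : R}
    (ha : ∀ z : ExtColimit I n (R ⧸ J), a • z = 0) (hi : i ≤ n)
    [Module.Finite R N] (hN : ∀ a ∈ J, ∀ x : N, a • x = 0) (z : ExtColimit I i N) :
    a • z = 0 := by
  obtain ⟨k, hk⟩ := Nat.exists_eq_add_of_le hi
  induction k generalizing i N with
  | zero =>
    obtain rfl : n = i := hk
    obtain ⟨m, π, hπ⟩ := exists_pi_surjective J hN
    have hK : Subsingleton (ExtColimit I (n + 1) (LinearMap.ker π)) :=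
      subsingleton_of_gt (fun j hj => h j hj.ne') (Nat.lt_succ_self n) fun a ha x =>
        Subtype.ext (funext fun j => smul_quotient_eq_zero ha _)
    obtain ⟨y, rfl⟩ := map_surjective_of_subsingleton (Submodule.injective_subtype _)
      (LinearMap.exact_subtype_ker_map π) hπ hK z
    rw [← map_smul, smul_eq_zero_of_pi ha, map_zero]
  | succ k ih =>
    obtain ⟨m, π, hπ⟩ := exists_pi_surjective J hN
    have hF : ∀ z : ExtColimit I i (Fin m → R ⧸ J), z = 0 := fun z => by
      have := h i (by omega)
      simpa using smul_eq_zero_of_pi (a := (1 : R)) (fun z => Subsingleton.elim _ _) z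
    have h1 : δ (Submodule.injective_subtype _) (LinearMap.exact_subtype_ker_map π) hπ i
        (a • z) = 0 := by
      rw [map_smul]
      exact ih (by omega) (fun a ha x =>
        Subtype.ext (funext fun j => smul_quotient_eq_zero ha _)) _ (by omega)
    obtain ⟨y, hy⟩ := (exact_map_δ (Submodule.injective_subtype _)
      (LinearMap.exact_subtype_ker_map π) hπ _).1 h1
    rw [← hy, hF y, map_zero]

lemma mem_of_forall_mem_sup_pow [IsNoetherianRing R] [IsLocalRing R] (hI : I ≠ ⊤)
    {J : Ideal R} {a : R} (h : ∀ t : ℕ, a ∈ J ⊔ I ^ t) : a ∈ J := by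
  rw [← Submodule.Quotient.mk_eq_zero, ← Submodule.mem_bot R,
    ← Ideal.iInf_pow_smul_eq_bot_of_isLocalRing (M := R ⧸ J) I hI, Submodule.mem_iInf]
  intro t
  obtain ⟨b, hb, c, hc, rfl⟩ := Submodule.mem_sup.1 (h t)
  rw [Submodule.Quotient.mk_add, (Submodule.Quotient.mk_eq_zero J).2 hb, zero_add]
  have : (Submodule.Quotient.mk c : R ⧸ J) = c • Submodule.Quotient.mk 1 := by
    rw [← Submodule.Quotient.mk_smul, smul_eq_mul, mul_one]
  rw [this]
  exact Submodule.smul_mem_smul hc trivial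

/-- The top local cohomology of `R ⧸ J` is faithful over `R ⧸ J`. -/
lemma mem_of_smul_eq_zero [IsNoetherianRing R] [IsLocalRing R] (hI : I ≠ ⊤)
    {J : Ideal R} {n : ℕ} (h : ∀ i, i ≠ n → Subsingleton (ExtColimit I i (R ⧸ J))) {a : R}
    (ha : ∀ z : ExtColimit I n (R ⧸ J), a • z = 0) : a ∈ J := by
  refine mem_of_forall_mem_sup_pow hI fun t => ?_
  let x : R ⧸ (J ⊔ I ^ t) := Submodule.Quotient.mk 1
  have hx : ∀ b ∈ I ^ t, b • x = 0 := fun b hb =>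
    smul_quotient_eq_zero (Ideal.mem_sup_right hb) _
  have hx' : ∀ b ∈ I ^ t, b • a • x = 0 := fun b hb =>
    smul_quotient_eq_zero (Ideal.mem_sup_right hb) _
  have h1 : a • ofTorsion hx = 0 := smul_eq_zero_of_le h ha (Nat.zero_le n)
    (fun b hb => smul_quotient_eq_zero (Ideal.mem_sup_left hb)) _
  rw [smul_ofTorsion hx a hx'] at h1
  have h2 := eq_zero_of_ofTorsion_eq_zero hx' h1
  rw [← Submodule.Quotient.mk_smul, Submodule.Quotient.mk_eq_zero] at h2
  simpa using h2

section Quotient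

variable [IsNoetherianRing R] [IsLocalRing R] {J : Ideal R} {n : ℕ} {x : R}

lemma isSMulRegular_of_surjective (hI : I ≠ ⊤)
    (h : ∀ i, i ≠ n → Subsingleton (ExtColimit I i (R ⧸ J)))
    (hx : Function.Surjective fun z : ExtColimit I n (R ⧸ J) => x • z) :
    IsSMulRegular (R ⧸ J) x := by
  rw [isSMulRegular_iff_right_eq_zero_of_smul]
  intro y hy
  obtain ⟨a, rfl⟩ := Submodule.Quotient.mk_surjective _ y
  rw [← Submodule.Quotient.mk_smul, Submodule.Quotient.mk_eq_zero] at hy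
  rw [Submodule.Quotient.mk_eq_zero]
  refine mem_of_smul_eq_zero hI h fun z => ?_
  obtain ⟨w, rfl⟩ := hx z
  change a • x • w = 0
  rw [smul_smul, mul_comm]
  exact smul_eq_zero_of_annihilates (smul_quotient_eq_zero hy) w

omit [IsNoetherianRing R] [IsLocalRing R] in
lemma subsingleton_quotient_sup (hreg : IsSMulRegular (R ⧸ J) x)
    (h : ∀ i, i ≠ n + 1 → Subsingleton (ExtColimit I i (R ⧸ J)))
    (hx : Function.Surjective fun z : ExtColimit I (n + 1) (R ⧸ J) => x • z)
    (hi : i ≠ n) : Subsingleton (ExtColimit I i (R ⧸ (J ⊔ Ideal.span {x}))) := by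
  have hreg' : Function.Injective (LinearMap.lsmul R (R ⧸ J) x) := hreg
  by_cases hi' : i = n + 1
  · subst hi'
    refine subsingleton_of_forall_eq 0 fun z => ?_
    obtain ⟨y, rfl⟩ := map_surjective_of_subsingleton hreg' (exact_lsmul_factor J x)
      (Submodule.factor_surjective _) (h _ (by omega)) z
    obtain ⟨w, rfl⟩ := hx y
    refine (exact_map_map hreg' (exact_lsmul_factor J x)
      (Submodule.factor_surjective _) _).2 ⟨w, map_lsmul_apply x w⟩
  · exact subsingleton_right hreg' (exact_lsmul_factor J x) (Submodule.factor_surjective _)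
      (h i hi') (h (i + 1) (by omega))

omit [IsNoetherianRing R] [IsLocalRing R] in
/-- The cohomology of `R ⧸ (J ⊔ (x))` as the `x`-torsion of the cohomology of `R ⧸ J`. -/
lemma nonempty_equiv_torsionBy (hreg : IsSMulRegular (R ⧸ J) x)
    (h : ∀ i, i ≠ n + 1 → Subsingleton (ExtColimit I i (R ⧸ J))) :
    Nonempty (ExtColimit I n (R ⧸ (J ⊔ Ideal.span {x})) ≃ₗ[R]
      Submodule.torsionBy R (ExtColimit I (n + 1) (R ⧸ J)) x) := by
  have hreg' : Function.Injective (LinearMap.lsmul R (R ⧸ J) x) := hreg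
  let d := δ (I := I) hreg' (exact_lsmul_factor J x) (Submodule.factor_surjective _) n
  have hd : Function.Injective d := by
    rw [← LinearMap.ker_eq_bot, eq_bot_iff]
    intro z hz
    obtain ⟨y, rfl⟩ := (exact_map_δ hreg' (exact_lsmul_factor J x)
      (Submodule.factor_surjective _) z).1 hz
    have := h n (by omega)
    rw [Subsingleton.elim y 0, map_zero]
    exact Submodule.zero_mem _
  refine ⟨LinearEquiv.ofInjective d hd ≪≫ₗ LinearEquiv.ofEq _ _ ?_⟩
  ext z
  rw [Submodule.mem_torsionBy_iff, ← map_lsmul_apply]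
  exact (exact_δ_map hreg' (exact_lsmul_factor J x) (Submodule.factor_surjective _) z).symm

omit [IsLocalRing R] in
lemma smul_surjective_of_subsingleton
    (h : ∀ i, i ≠ n + 1 → Subsingleton (ExtColimit I i (R ⧸ J)))
    (h' : Subsingleton (ExtColimit I (n + 1) (R ⧸ (J ⊔ Ideal.span {x})))) :
    Function.Surjective fun z : ExtColimit I (n + 1) (R ⧸ J) => x • z := by
  intro z
  let l := LinearMap.lsmul R (R ⧸ J) x
  have hK : Subsingleton (ExtColimit I (n + 1 + 1) (LinearMap.ker l)) :=
    subsingleton_of_gt (J := J) (n := n + 1) (fun j hj => h j (by omega)) (by omega)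
      fun a ha y => Subtype.ext (smul_quotient_eq_zero ha _)
  have hex : Function.Exact (LinearMap.range l).subtype
      (Submodule.factor (le_sup_left : J ≤ J ⊔ Ideal.span {x})) := by
    intro y
    rw [exact_lsmul_factor J x y]
    simp [l]
  obtain ⟨y, rfl⟩ := (exact_map_map (Submodule.injective_subtype _) hex
    (Submodule.factor_surjective _) z).1 (Subsingleton.elim _ _)
  obtain ⟨w, rfl⟩ := map_surjective_of_subsingleton (f := (LinearMap.ker l).subtype)
    (g := l.rangeRestrict) (Submodule.injective_subtype _)
    (fun y => by simp [Subtype.ext_iff]) l.surjective_rangeRestrict hK y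
  refine ⟨w, ?_⟩
  change x • w = _
  rw [← map_comp_apply, ← map_lsmul_apply]
  rfl

end Quotient

end ExtColimit

section Dual

variable {R : Type u} [CommRing R] {E : Type u} [AddCommGroup E] [Module R E]
  {H : Type u} [AddCommGroup H] [Module R H] {x : R}

lemma isSMulRegular_dual (hx : Function.Surjective fun h : H => x • h) :
    IsSMulRegular (H →ₗ[R] E) x := by
  intro φ ψ h
  refine LinearMap.ext fun y => ?_
  obtain ⟨w, rfl⟩ := hx y
  simpa using LinearMap.congr_fun h w

lemma surjective_of_isSMulRegular_dual
    (hE : ∀ (M : Type u) [AddCommGroup M] [Module R M] (m : M), m ≠ 0 →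
      ∃ φ : M →ₗ[R] E, φ m ≠ 0) (hx : IsSMulRegular (H →ₗ[R] E) x) :
    Function.Surjective fun h : H => x • h := by
  change Function.Surjective (LinearMap.lsmul R H x)
  rw [← LinearMap.range_eq_top, Submodule.eq_top_iff']
  intro h
  by_contra hh
  rw [← Submodule.Quotient.mk_eq_zero] at hh
  obtain ⟨φ, hφ⟩ := hE _ _ hh
  have : φ ∘ₗ Submodule.mkQ _ = 0 := by
    apply hx
    refine LinearMap.ext fun y => ?_
    change x • φ (Submodule.Quotient.mk y) = x • (0 : E)
    have hy : (Submodule.Quotient.mk (x • y) :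
        H ⧸ LinearMap.range (LinearMap.lsmul R H x)) = 0 :=
      (Submodule.Quotient.mk_eq_zero _).2 ⟨y, rfl⟩
    rw [smul_zero, ← map_smul, ← Submodule.Quotient.mk_smul, hy, map_zero]
  exact hφ (LinearMap.congr_fun this h)

/-- The dual of the `x`-torsion is the quotient of the dual modulo `x`. -/
lemma nonempty_quotSMulTop_dual_equiv (hE : Module.Injective R E)
    (hx : Function.Surjective fun h : H => x • h) :
    Nonempty (QuotSMulTop x (H →ₗ[R] E) ≃ₗ[R] (Submodule.torsionBy R H x →ₗ[R] E)) := by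
  let ρ : (H →ₗ[R] E) →ₗ[R] (Submodule.torsionBy R H x →ₗ[R] E) :=
    LinearMap.lcomp R E (Submodule.torsionBy R H x).subtype
  have hρ : Function.Surjective ρ := fun φ => by
    obtain ⟨ψ, hψ⟩ := hE.out _ (Submodule.injective_subtype (Submodule.torsionBy R H x)) φ
    exact ⟨ψ, LinearMap.ext hψ⟩
  refine ⟨Submodule.quotEquivOfEq _ _ ?_ ≪≫ₗ ρ.quotKerEquivOfSurjective hρ⟩
  ext φ
  rw [Submodule.mem_smul_pointwise_iff_exists, LinearMap.mem_ker]
  constructor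
  · rintro ⟨ψ, -, rfl⟩
    refine LinearMap.ext fun y => ?_
    change x • ψ y = 0
    rw [← map_smul, (Submodule.mem_torsionBy_iff _ _).1 y.2, map_zero]
  · intro h
    let l := LinearMap.lsmul R H x
    have hl : LinearMap.ker l ≤ LinearMap.ker φ := fun y hy =>
      LinearMap.congr_fun h ⟨y, hy⟩
    let e := l.quotKerEquivOfSurjective hx
    refine ⟨Submodule.liftQ _ φ hl ∘ₗ e.symm.toLinearMap, trivial, LinearMap.ext fun y => ?_⟩
    have hy : e.symm (x • y) = Submodule.Quotient.mk y := (LinearEquiv.symm_apply_eq e).2 rfl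
    change x • Submodule.liftQ _ φ hl (e.symm y) = φ y
    rw [← map_smul, ← map_smul, hy]
    rfl

end Dual

namespace ExtColimit

variable {R : Type u} [CommRing R] [IsNoetherianRing R] [IsLocalRing R] {I : Ideal R}
  {E : Type u} [AddCommGroup E] [Module R E]

omit [IsLocalRing R] in
lemma subsingleton_quotient_powTorsion {M : Type u} [AddCommGroup M] [Module R M]
    (h : ∀ i, Subsingleton (ExtColimit I (i + 1) M)) (i : ℕ) :
    Subsingleton (ExtColimit I i (M ⧸ powTorsion I M)) := by
  have hT : ∀ i, Subsingleton (ExtColimit I (i + 1) (powTorsion I M)) := fun i =>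
    subsingleton_of_isPowTorsion i isPowTorsion_powTorsion
  cases i with
  | zero =>
    refine subsingleton_of_forall_eq 0 fun z => ?_
    obtain ⟨y, rfl⟩ := map_surjective_of_subsingleton (Submodule.injective_subtype _)
      (LinearMap.exact_subtype_mkQ _) (Submodule.mkQ_surjective _) (hT 0) z
    obtain ⟨t, m, hm, rfl⟩ := exists_ofTorsion y
    rw [map_ofTorsion _ _ fun a ha => by rw [← map_smul, hm a ha, map_zero]]
    refine ofTorsion_eq_zero _ ?_
    rw [Submodule.mkQ_apply, Submodule.Quotient.mk_eq_zero]
    exact ⟨t, hm⟩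
  | succ i =>
    exact subsingleton_right (Submodule.injective_subtype _) (LinearMap.exact_subtype_mkQ _)
      (Submodule.mkQ_surjective _) (h i) (hT (i + 1))

lemma le_radical_of_subsingleton (hI : I ≠ ⊤) {J : Ideal R}
    (h : ∀ i, Subsingleton (ExtColimit I (i + 1) (R ⧸ J))) : I ≤ J.radical := by
  let π : R →ₗ[R] (R ⧸ J) ⧸ powTorsion I (R ⧸ J) := Submodule.mkQ _ ∘ₗ Submodule.mkQ J
  have hπ : Function.Surjective π :=
    (Submodule.mkQ_surjective _).comp (Submodule.mkQ_surjective _)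
  have h1 : LinearMap.ker π = ⊤ := eq_top_of_forall_subsingleton hI _ fun i =>
    subsingleton_of_equiv (π.quotKerEquivOfSurjective hπ).symm
      (subsingleton_quotient_powTorsion h i)
  have h2 : (1 : R) ∈ LinearMap.ker π := h1 ▸ Submodule.mem_top
  rw [LinearMap.mem_ker] at h2
  obtain ⟨t, ht⟩ := (Submodule.Quotient.mk_eq_zero (powTorsion I (R ⧸ J))).1 h2
  refine fun a ha => ⟨t, ?_⟩
  have := ht _ (Ideal.pow_mem_pow ha t)
  rw [Submodule.mkQ_apply, ← Submodule.Quotient.mk_smul, Submodule.Quotient.mk_eq_zero] at this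
  simpa using this

/-- The main equivalence, for cyclic modules with cohomology in a single degree. -/
theorem le_radical_iff_isRegular (hI : I ≠ ⊤) (hE : Module.Injective R E)
    (hE' : ∀ (M : Type u) [AddCommGroup M] [Module R M] (m : M), m ≠ 0 →
      ∃ φ : M →ₗ[R] E, φ m ≠ 0)
    (fs : List R) (hfs : ∀ f ∈ fs, f ∈ I) {J : Ideal R} (hJ : J ≠ ⊤)
    (h : ∀ i, i ≠ fs.length → Subsingleton (ExtColimit I i (R ⧸ J))) :
    I ≤ (J ⊔ Ideal.ofList fs).radical ↔
      RingTheory.Sequence.IsRegular (ExtColimit I fs.length (R ⧸ J) →ₗ[R] E) fs := by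
  induction fs generalizing J with
  | nil =>
    refine iff_of_true ?_ ?_
    · rw [Ideal.ofList_nil, sup_bot_eq]
      exact le_radical_of_subsingleton hI fun i => h _ (by simp)
    · rw [RingTheory.Sequence.isRegular_iff]
      refine ⟨RingTheory.Sequence.IsWeaklyRegular.nil R _, ?_⟩
      rw [Ideal.ofList_nil, Submodule.bot_smul]
      intro he
      refine hJ (eq_top_of_forall_subsingleton hI J fun i => ?_)
      by_cases hi : i = 0
      · subst hi
        refine subsingleton_of_forall_eq 0 fun z => ?_
        by_contra hz
        obtain ⟨φ, hφ⟩ := hE' _ z hz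
        have : φ = 0 := by
          rw [← Submodule.mem_bot R, ← he]
          trivial
        rw [this] at hφ
        exact hφ rfl
      · exact h i hi
  | cons f fs ih =>
    have hfI : f ∈ I := hfs f (by simp)
    have hJ' : J ⊔ Ideal.span {f} ≠ ⊤ := by
      have : J ⊔ Ideal.span {f} ≤ IsLocalRing.maximalIdeal R :=
        sup_le (IsLocalRing.le_maximalIdeal hJ)
          ((Ideal.span_singleton_le_iff_mem _).2 (IsLocalRing.le_maximalIdeal hI hfI))
      exact fun e => (Ideal.IsMaximal.ne_top inferInstance) (top_le_iff.1 (e ▸ this))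
    have hsup : J ⊔ Ideal.ofList (f :: fs) = (J ⊔ Ideal.span {f}) ⊔ Ideal.ofList fs := by
      rw [Ideal.ofList_cons, sup_assoc]
    rw [List.length_cons] at h
    rw [hsup, RingTheory.Sequence.isRegular_cons_iff, List.length_cons]
    have key : (Function.Surjective fun z : ExtColimit I (fs.length + 1) (R ⧸ J) => f • z) →
        (I ≤ ((J ⊔ Ideal.span {f}) ⊔ Ideal.ofList fs).radical ↔
          RingTheory.Sequence.IsRegular
            (QuotSMulTop f (ExtColimit I (fs.length + 1) (R ⧸ J) →ₗ[R] E)) fs) := by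
      intro hsurj
      have hreg := isSMulRegular_of_surjective hI h hsurj
      obtain ⟨e₁⟩ := nonempty_equiv_torsionBy hreg h
      obtain ⟨e₂⟩ := nonempty_quotSMulTop_dual_equiv hE hsurj
      rw [ih (fun g hg => hfs g (by simp [hg])) hJ'
        (fun i hi => subsingleton_quotient_sup hreg h hsurj hi), e₂.isRegular_congr,
        (e₁.congrLeft E R).isRegular_congr]
    constructor
    · intro hrad
      have hsurj : Function.Surjective
          fun z : ExtColimit I (fs.length + 1) (R ⧸ J) => f • z := by
        refine smul_surjective_of_subsingleton h (subsingleton_of_length_lt fs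
          (fun g hg => hfs g (by simp [hg])) (fun m => ?_) (Nat.lt_succ_self _))
        refine hrad.trans (Ideal.radical_mono (sup_le_sup_right (fun a ha => ?_) _))
        exact smul_quotient_eq_zero ha m
      exact ⟨isSMulRegular_dual hsurj, (key hsurj).1 hrad⟩
    · rintro ⟨hreg, hreg'⟩
      exact (key (surjective_of_isSMulRegular_dual hE' hreg)).2 hreg'

end ExtColimit

namespace HomologicalComplex

variable {R : Type u} [Ring R] {κ : Type*} {c : ComplexShape κ}
  (K : HomologicalComplex (ModuleCat.{u} R) c)

lemma exists_iCycles_eq {i j : κ} (hj : c.next i = j) (x : K.X i) (hx : K.d i j x = 0) :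
    ∃ y : K.cycles i, K.iCycles i y = x := by
  have := ShortComplex.exact_of_f_is_kernel
    (ShortComplex.mk (K.iCycles i) (K.d i j) (K.iCycles_d i j)) (K.cyclesIsKernel i j hj)
  exact (ShortComplex.moduleCat_exact_iff _).1 this x hx

lemma exists_d_eq_iCycles {i j : κ} (hi : c.prev j = i) (x : K.cycles j)
    (hx : K.homologyπ j x = 0) : ∃ y : K.X i, K.d i j y = K.iCycles j x := by
  have := ShortComplex.exact_of_g_is_cokernel
    (ShortComplex.mk (K.toCycles i j) (K.homologyπ j) (K.toCycles_comp_homologyπ i j))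
    (K.homologyIsCokernel i j hi)
  obtain ⟨y, hy⟩ := (ShortComplex.moduleCat_exact_iff _).1 this x hx
  refine ⟨y, ?_⟩
  rw [← hy, ← ConcreteCategory.comp_apply]
  exact (ConcreteCategory.congr_hom (K.toCycles_i i j) y).symm

lemma homologyπ_eq_zero_of_d_eq {i j : κ} {x : K.cycles j} (y : K.X i)
    (hy : K.d i j y = K.iCycles j x) : K.homologyπ j x = 0 := by
  have hx : K.toCycles i j y = x := by
    apply (ModuleCat.mono_iff_injective (K.iCycles j)).1 inferInstance
    rw [← hy, ← ConcreteCategory.comp_apply]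
    exact ConcreteCategory.congr_hom (K.toCycles_i i j) y
  rw [← hx, ← ConcreteCategory.comp_apply, K.toCycles_comp_homologyπ]
  rfl

end HomologicalComplex

lemma CategoryTheory.unop_naturality {D : Type*} [Category* D] {L L' M M' : Dᵒᵖ} {H H' : D}
    (a : L ≅ M) (a' : L' ≅ M') (o : M ≅ Opposite.op H) (o' : M' ≅ Opposite.op H')
    {l : L' ⟶ L} {m : M' ⟶ M} {h : H ⟶ H'}
    (h₁ : a'.inv ≫ l = m ≫ a.inv) (h₂ : m ≫ o.hom = o'.hom ≫ h.op) :
    l.unop ≫ (a'.unop.symm ≪≫ o'.unop.symm).hom = (a.unop.symm ≪≫ o.unop.symm).hom ≫ h := by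
  apply Quiver.Hom.op_inj
  change (o'.inv ≫ a'.inv) ≫ l = h.op ≫ o.inv ≫ a.inv
  rw [Category.assoc, h₁, Iso.inv_comp_eq, ← reassoc_of% h₂, Iso.hom_inv_id_assoc]

namespace CategoryTheory.ProjectiveResolution

variable {R : Type u} [CommRing R] {X Y X' : ModuleCat.{u} R} (P : ProjectiveResolution X)
  (P' : ProjectiveResolution X')

lemma smul_extMk {n : ℕ} (r : R) (f : P.complex.X n ⟶ Y) (m : ℕ) (hm : n + 1 = m)
    (hf : P.complex.d m n ≫ f = 0) :
    r • P.extMk f m hm hf = P.extMk (r • f) m hm (by simp [hf]) := by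
  have h := P.extMk_comp_mk₀ f m hm hf (r • 𝟙 Y)
  rw [Ext.mk₀_smul, Ext.comp_smul, Ext.comp_mk₀_id] at h
  simpa using h

/-- The complex `Hom(P, Y)`. -/
noncomputable abbrev homComplex (Y : ModuleCat.{u} R) : CochainComplex (ModuleCat.{u} R) ℕ :=
  P.complex.linearYonedaObj R Y

variable (Y)

/-- The inclusion of the cocycles of `Hom(P, Y)`. -/
noncomputable def cyclesToHom (n : ℕ) : (P.homComplex Y).cycles n →ₗ[R] (P.complex.X n ⟶ Y) :=
  ((P.homComplex Y).iCycles n).hom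

lemma d_comp_cyclesToHom {n : ℕ} (x : (P.homComplex Y).cycles n) :
    P.complex.d (n + 1) n ≫ P.cyclesToHom Y n x = 0 :=
  ConcreteCategory.congr_hom ((P.homComplex Y).iCycles_d n (n + 1)) x

/-- The class in `Ext` of a cocycle of `Hom(P, Y)`. -/
noncomputable def extOfCycles (n : ℕ) : (P.homComplex Y).cycles n →ₗ[R] Ext X Y n where
  toFun x := P.extMk (P.cyclesToHom Y n x) (n + 1) rfl (P.d_comp_cyclesToHom Y x)
  map_add' x y := by
    rw [add_extMk]
    congr 1
    exact map_add _ x y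
  map_smul' r x := by
    rw [RingHom.id_apply, smul_extMk]
    congr 1
    exact map_smul _ r x

lemma extOfCycles_apply {n : ℕ} (x : (P.homComplex Y).cycles n) {f : P.complex.X n ⟶ Y}
    (hf : P.complex.d (n + 1) n ≫ f = 0) (hx : P.cyclesToHom Y n x = f) :
    P.extOfCycles Y n x = P.extMk f (n + 1) rfl hf := by
  subst hx
  rfl

lemma extOfCycles_surjective (n : ℕ) : Function.Surjective (P.extOfCycles Y n) := by
  intro α
  obtain ⟨f, hf, rfl⟩ := P.extMk_surjective α (n + 1) rfl
  obtain ⟨x, hx⟩ := (P.homComplex Y).exists_iCycles_eq (CochainComplex.next ℕ n) f hf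
  exact ⟨x, P.extOfCycles_apply Y x hf hx⟩

lemma extOfCycles_eq_zero {n : ℕ} {x : (P.homComplex Y).cycles n}
    (hx : (P.homComplex Y).homologyπ n x = 0) : P.extOfCycles Y n x = 0 := by
  cases n with
  | zero =>
    obtain ⟨y, hy⟩ := (P.homComplex Y).exists_d_eq_iCycles CochainComplex.prev_nat_zero x hx
    rw [(P.homComplex Y).shape 0 0 (by simp)] at hy
    rw [P.extOfCycles_apply Y x Limits.comp_zero hy.symm]
    exact P.extMk_zero _ _
  | succ n =>
    obtain ⟨y, hy⟩ := (P.homComplex Y).exists_d_eq_iCycles (CochainComplex.prev_nat_succ n) x hx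
    exact (P.extMk_eq_zero_iff _ _ rfl (P.d_comp_cyclesToHom Y x) n rfl).2 ⟨y, hy⟩

lemma homologyπ_eq_zero {n : ℕ} {x : (P.homComplex Y).cycles (n + 1)}
    (hx : P.extOfCycles Y (n + 1) x = 0) : (P.homComplex Y).homologyπ (n + 1) x = 0 := by
  obtain ⟨y, hy⟩ := (P.extMk_eq_zero_iff _ _ rfl (P.d_comp_cyclesToHom Y x) n rfl).1 hx
  exact (P.homComplex Y).homologyπ_eq_zero_of_d_eq y hy

lemma homologyπ_surjective (n : ℕ) : Function.Surjective ((P.homComplex Y).homologyπ n) :=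
  (ModuleCat.epi_iff_surjective _).1 inferInstance

/-- The comparison map from the cohomology of `Hom(P, Y)` to `Ext`. -/
noncomputable def extOfHomology (n : ℕ) : (P.homComplex Y).homology n →ₗ[R] Ext X Y n :=
  ((LinearMap.ker ((P.homComplex Y).homologyπ n).hom).liftQ (P.extOfCycles Y n)
      fun _ hx => P.extOfCycles_eq_zero Y hx) ∘ₗ
    (((P.homComplex Y).homologyπ n).hom.quotKerEquivOfSurjective
      (P.homologyπ_surjective Y n)).symm.toLinearMap

lemma extOfHomology_homologyπ {n : ℕ} (x : (P.homComplex Y).cycles n) :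
    P.extOfHomology Y n ((P.homComplex Y).homologyπ n x) = P.extOfCycles Y n x := by
  have : (((P.homComplex Y).homologyπ n).hom.quotKerEquivOfSurjective
      (P.homologyπ_surjective Y n)).symm ((P.homComplex Y).homologyπ n x) =
      Submodule.Quotient.mk x := by
    rw [LinearEquiv.symm_apply_eq]
    rfl
  rw [extOfHomology, LinearMap.comp_apply, LinearEquiv.coe_coe, this]
  rfl

lemma extOfHomology_surjective (n : ℕ) : Function.Surjective (P.extOfHomology Y n) := fun α => by
  obtain ⟨x, rfl⟩ := P.extOfCycles_surjective Y n α
  exact ⟨_, P.extOfHomology_homologyπ Y x⟩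

lemma extOfHomology_injective (n : ℕ) : Function.Injective (P.extOfHomology Y (n + 1)) := by
  rw [injective_iff_map_eq_zero]
  intro x hx
  obtain ⟨x, rfl⟩ := P.homologyπ_surjective Y (n + 1) x
  rw [extOfHomology_homologyπ] at hx
  exact P.homologyπ_eq_zero Y hx

variable {P P'} in
/-- The map on `Hom` complexes induced by a morphism of projective resolutions. -/
noncomputable def homComplexMap {g : X' ⟶ X} (φ : Hom P' P g) :
    P.homComplex Y ⟶ P'.homComplex Y :=
  (HomologicalComplex.unopFunctor _ _).map
    ((((linearYoneda R _).obj Y).rightOp.mapHomologicalComplex _).map φ.hom).op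

variable {P P'} in
lemma extOfHomology_homologyMap {g : X' ⟶ X} (φ : Hom P' P g) (n : ℕ)
    (x : (P.homComplex Y).homology n) :
    P'.extOfHomology Y n (HomologicalComplex.homologyMap (homComplexMap Y φ) n x) =
      (Ext.mk₀ g).comp (P.extOfHomology Y n x) (zero_add n) := by
  obtain ⟨x, rfl⟩ := P.homologyπ_surjective Y n x
  rw [← ConcreteCategory.comp_apply, HomologicalComplex.homologyπ_naturality,
    ConcreteCategory.comp_apply, extOfHomology_homologyπ, extOfHomology_homologyπ]
  rw [P.extOfCycles_apply Y x (P.d_comp_cyclesToHom Y x) rfl, mk₀_comp_extMk _ _ _ _ φ]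
  exact P'.extOfCycles_apply Y _ _
    (ConcreteCategory.congr_hom (HomologicalComplex.cyclesMap_i (homComplexMap Y φ) n) x)

variable {P P'} in
lemma isoExt_hom_naturality {g : X' ⟶ X} (φ : Hom P' P g) (n : ℕ) :
    ((_root_.Ext R (ModuleCat.{u} R) n).map g.op).app Y ≫ (P'.isoExt n Y).hom =
      (P.isoExt n Y).hom ≫ HomologicalComplex.homologyMap (homComplexMap Y φ) n := by
  refine unop_naturality _ _ _ _
    (isoLeftDerivedObj_inv_naturality g P' P φ.hom
      (by simpa using φ.hom_f_zero_comp_π_f_zero)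
      ((linearYoneda R (ModuleCat.{u} R)).obj Y).rightOp n)
    (HomologicalComplex.homologyOp_hom_naturality (homComplexMap Y φ) n)

end CategoryTheory.ProjectiveResolution

namespace ExtColimit

variable {R : Type} [CommRing R]

/-- The comparison map from `Ext` defined as a derived functor. -/
noncomputable def extComparison (X Y : ModuleCat.{0} R) (n : ℕ) :
    ((_root_.Ext R (ModuleCat.{0} R) n).obj (Opposite.op X)).obj Y →ₗ[R] Ext X Y n :=
  (ProjectiveResolution.of X).extOfHomology Y n ∘ₗ
    ((ProjectiveResolution.of X).isoExt n Y).hom.hom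

lemma extComparison_surjective (X Y : ModuleCat.{0} R) (n : ℕ) :
    Function.Surjective (extComparison X Y n) :=
  ((ProjectiveResolution.of X).extOfHomology_surjective Y n).comp
    (((ProjectiveResolution.of X).isoExt (R := R) n Y).toLinearEquiv.surjective)

lemma extComparison_injective (X Y : ModuleCat.{0} R) (n : ℕ) :
    Function.Injective (extComparison X Y (n + 1)) :=
  ((ProjectiveResolution.of X).extOfHomology_injective Y n).comp
    (((ProjectiveResolution.of X).isoExt (R := R) (n + 1) Y).toLinearEquiv.injective)

lemma extComparison_naturality {X X' : ModuleCat.{0} R} (g : X' ⟶ X) (Y : ModuleCat.{0} R)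
    (n : ℕ) (x : ((_root_.Ext R (ModuleCat.{0} R) n).obj (Opposite.op X)).obj Y) :
    extComparison X' Y n (((_root_.Ext R (ModuleCat.{0} R) n).map g.op).app Y x) =
      (Ext.mk₀ g).comp (extComparison X Y n x) (zero_add n) := by
  let φ : ProjectiveResolution.Hom (ProjectiveResolution.of X') (ProjectiveResolution.of X) g :=
    { hom := ProjectiveResolution.lift g _ _
      hom_f_zero_comp_π_f_zero := ProjectiveResolution.lift_commutes_zero g _ _ }
  generalize φ = ψ
  refine Eq.trans ?_ (ProjectiveResolution.extOfHomology_homologyMap Y ψ n _)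
  exact congr_arg ((ProjectiveResolution.of X').extOfHomology Y n)
    (ConcreteCategory.congr_hom (ProjectiveResolution.isoExt_hom_naturality Y ψ n) x)

variable (I : Ideal R) (i : ℕ) (M : Type) [AddCommGroup M] [Module R M]

/-- The comparison maps `Ext^i(R ⧸ I ^ t, M) → ExtColimit I i M`. -/
noncomputable def comparisonCocone :
    Limits.Cocone (localCohomology.diagram (localCohomology.idealPowersDiagram I) i ⋙
      (evaluation _ _).obj (ModuleCat.of R M)) where
  pt := ModuleCat.of R (ExtColimit I i M)
  ι :=
    { app t := ModuleCat.ofHom (ι I i M t.unop.unop ∘ₗ extComparison _ _ i)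
      naturality s t w := by
        ext x
        have h : s.unop.unop ≤ t.unop.unop := w.unop.unop.down.down
        have := ι_transition h (extComparison (ModuleCat.of R (R ⧸ I ^ s.unop.unop))
          (ModuleCat.of R M) i x)
        refine Eq.trans ?_ this
        rw [transition_apply]
        exact congr_arg (ι I i M t.unop.unop) (extComparison_naturality (proj I h) _ i x) }

/-- The colimit cocone computing local cohomology. -/
noncomputable def isColimitMapCocone :
    Limits.IsColimit (((evaluation _ _).obj (ModuleCat.of R M)).mapCocone
      (Limits.colimit.cocone
        (localCohomology.diagram (localCohomology.idealPowersDiagram I) i))) :=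
  Limits.isColimitOfPreserves _ (Limits.colimit.isColimit _)

/-- The comparison map from local cohomology. -/
noncomputable def comparison :
    (localCohomology I i).obj (ModuleCat.of R M) →ₗ[R] ExtColimit I i M :=
  ((isColimitMapCocone I i M).desc (comparisonCocone I i M)).hom

/-- The structure maps of local cohomology. -/
noncomputable def localCohomologyι (t : ℕ) :
    ((_root_.Ext R (ModuleCat.{0} R) i).obj (Opposite.op (ModuleCat.of R (R ⧸ I ^ t)))).obj
      (ModuleCat.of R M) →ₗ[R] (localCohomology I i).obj (ModuleCat.of R M) :=
  ((Limits.colimit.ι (localCohomology.diagram (localCohomology.idealPowersDiagram I) i)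
    (Opposite.op (Opposite.op t))).app (ModuleCat.of R M)).hom

lemma exists_localCohomologyι (z : (localCohomology I i).obj (ModuleCat.of R M)) :
    ∃ t x, localCohomologyι I i M t x = z := by
  obtain ⟨t, x, hx⟩ := Limits.Concrete.isColimit_exists_rep _ (isColimitMapCocone I i M) z
  exact ⟨t.unop.unop, x, hx⟩

lemma comparison_localCohomologyι (t : ℕ)
    (x : ((_root_.Ext R (ModuleCat.{0} R) i).obj
      (Opposite.op (ModuleCat.of R (R ⧸ I ^ t)))).obj (ModuleCat.of R M)) :
    comparison I i M (localCohomologyι I i M t x) = ι I i M t (extComparison _ _ i x) :=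
  ConcreteCategory.congr_hom ((isColimitMapCocone I i M).fac (comparisonCocone I i M)
    (Opposite.op (Opposite.op t))) x

lemma localCohomologyι_map {s t : ℕ} (h : s ≤ t)
    (x : ((_root_.Ext R (ModuleCat.{0} R) i).obj
      (Opposite.op (ModuleCat.of R (R ⧸ I ^ s)))).obj (ModuleCat.of R M)) :
    localCohomologyι I i M t (((_root_.Ext R (ModuleCat.{0} R) i).map (proj I h).op).app
      (ModuleCat.of R M) x) = localCohomologyι I i M s x :=
  ConcreteCategory.congr_hom (NatTrans.congr_app (Limits.colimit.w
    (localCohomology.diagram (localCohomology.idealPowersDiagram I) i)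
      (homOfLE h).op.op) (ModuleCat.of R M)) x

lemma comparison_surjective : Function.Surjective (comparison I i M) := fun z => by
  obtain ⟨t, y, rfl⟩ := exists_ι z
  obtain ⟨x, rfl⟩ := extComparison_surjective _ _ i y
  exact ⟨_, comparison_localCohomologyι I i M t x⟩

lemma comparison_injective : Function.Injective (comparison I (i + 1) M) := by
  rw [injective_iff_map_eq_zero]
  intro z hz
  obtain ⟨t, x, rfl⟩ := exists_localCohomologyι I (i + 1) M z
  rw [comparison_localCohomologyι] at hz
  obtain ⟨s, h, hs⟩ := ι_eq_zero hz
  rw [transition_apply, ← extComparison_naturality,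
    map_eq_zero_iff _ (extComparison_injective _ _ i)] at hs
  rw [← localCohomologyι_map I (i + 1) M h, hs, map_zero]

end ExtColimit

end

/-- An injective hull of the residue field is a cogenerator. -/
lemma IsInjectiveHullOfResidueField.exists_apply_ne_zero {R : Type} [CommRing R]
    [IsLocalRing R] {E : Type} [AddCommGroup E] [Module R E]
    (hE : IsInjectiveHullOfResidueField R E) {M : Type} [AddCommGroup M] [Module R M] {m : M}
    (hm : m ≠ 0) : ∃ φ : M →ₗ[R] E, φ m ≠ 0 := by
  obtain ⟨hE, f, hf, -⟩ := hE
  let τ := LinearMap.toSpanSingleton R M m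
  have hJ : LinearMap.ker τ ≤ LinearMap.ker (f ∘ₗ Algebra.linearMap R (ResidueField R)) := by
    intro r hr
    have hr' : r ∈ maximalIdeal R := by
      rw [mem_maximalIdeal, mem_nonunits_iff]
      intro hu
      exact hm (hu.smul_eq_zero.1 hr)
    rw [LinearMap.mem_ker, LinearMap.comp_apply, Algebra.linearMap_apply,
      ResidueField.algebraMap_eq, (residue_eq_zero_iff r).2 hr', map_zero]
  obtain ⟨φ, hφ⟩ := hE.out ((LinearMap.ker τ).liftQ τ le_rfl)
    (LinearMap.ker_eq_bot.1 (Submodule.ker_liftQ_eq_bot _ _ _ le_rfl))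
    ((LinearMap.ker τ).liftQ _ hJ)
  refine ⟨φ, fun h => ?_⟩
  have h₁ := hφ (Submodule.Quotient.mk 1)
  rw [Submodule.liftQ_apply, Submodule.liftQ_apply, LinearMap.toSpanSingleton_apply, one_smul, h,
    LinearMap.comp_apply, eq_comm, map_eq_zero_iff _ hf, Algebra.linearMap_apply, map_one] at h₁
  exact one_ne_zero h₁


/-- Let `(R,m)` be a noetherian local ring, `I` a proper ideal, `n ≥ 1`,
`f_1, …, f_n ∈ I`, and assume `H^l_I(R) = 0` for all `l ≠ n`.  Then
`√I = √((f_1,…,f_n)R)` iff `f_1, …, f_n` is a regular sequence on the Matlis dual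
`D(H^n_I(R))`. -/
theorem stmt2 (R : Type) [CommRing R] [IsLocalRing R] [IsNoetherianRing R]
    (I : Ideal R) (hI : I ≠ ⊤) (n : ℕ) (hn : 1 ≤ n) (f : Fin n → R) (hf : ∀ i, f i ∈ I)
    (hvanish : ∀ l : ℕ, l ≠ n → Subsingleton (LocalCohomologyModule I l R))
    (E : Type) [AddCommGroup E] [Module R E] (hE : IsInjectiveHullOfResidueField R E) :
    I.radical = (Ideal.span (Set.range f)).radical ↔
      RingTheory.Sequence.IsRegular (LocalCohomologyModule I n R →ₗ[R] E)
        (List.ofFn f) := by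
  have hlen : (List.ofFn f).length = n := List.length_ofFn
  let q (i : ℕ) : ExtColimit I i (R ⧸ (⊥ : Ideal R)) ≃ₗ[R] ExtColimit I i R :=
    ExtColimit.mapEquiv (Submodule.quotEquivOfEqBot (⊥ : Ideal R) rfl)
  have key := ExtColimit.le_radical_iff_isRegular hI hE.1
    (fun M _ _ m hm => hE.exists_apply_ne_zero hm) (List.ofFn f)
    (by simpa [List.mem_ofFn] using hf) (J := ⊥) bot_ne_top (fun i hi => by
      rw [hlen] at hi
      have := hvanish i hi
      have := (ExtColimit.comparison_surjective I i R).subsingleton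
      exact (q i).injective.subsingleton)
  rw [hlen, bot_sup_eq] at key
  have hspan : Ideal.ofList (List.ofFn f) = Ideal.span (Set.range f) := by
    rw [Ideal.ofList]
    congr 1
    ext x
    simp [List.mem_ofFn]
  rw [hspan] at key
  obtain ⟨k, rfl⟩ : ∃ k, n = k + 1 := ⟨n - 1, by omega⟩
  let e : LocalCohomologyModule I (k + 1) R ≃ₗ[R] ExtColimit I (k + 1) (R ⧸ (⊥ : Ideal R)) :=
    LinearEquiv.ofBijective (ExtColimit.comparison I (k + 1) R)
      ⟨ExtColimit.comparison_injective I k R, ExtColimit.comparison_surjective I (k + 1) R⟩ ≪≫ₗ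
      (q (k + 1)).symm
  rw [LinearEquiv.isRegular_congr (LinearEquiv.congrLeft E R e), ← key]
  have hle : Ideal.span (Set.range f) ≤ I := Ideal.span_le.2 (by rintro _ ⟨i, rfl⟩; exact hf i)
  constructor
  · intro h
    exact h ▸ Ideal.le_radical
  · intro h
    exact le_antisymm (Ideal.radical_le_radical_iff.2 h) (Ideal.radical_mono hle)
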